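/- Let n ≥ 1, let T ⊆ [-1,1), let C be an (N,n,T) spherical code with N ≥ 2, and let F : [-1,1]³ → ℝ be a symmetric function. Suppose h : [-1,1] → ℝ and g : T → ℝ are such that (1) h(t) + 1 + F(1,t,t) ≤ 2g(t) for all t ∈ T, and (2) F(t,u,v) ≤ g(t) + g(u) + g(v) for all (t,u,v) ∈ D₃(T). If S_F(C) ≥ 0 and S_h(C) ≥ 0, then R_g(C) ≥ (N − M)/(3N), where M = F(1,1,1) + 3h(1). -/

import Mathlib

open Finset RealInnerProductSpace

/-- The Gram determinant of three unit vectors is nonnegative. -/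
theorem gram_det_nonneg_of_norm_eq_one {E : Type*} [NormedAddCommGroup E] [InnerProductSpace ℝ E]
    {x y z : E} (hx : ‖x‖ = 1) (hy : ‖y‖ = 1) (hz : ‖z‖ = 1) :
    0 ≤ 1 + 2 * ⟪x, y⟫ * ⟪x, z⟫ * ⟪y, z⟫ - ⟪x, y⟫ ^ 2 - ⟪x, z⟫ ^ 2 - ⟪y, z⟫ ^ 2 := by
  have key := real_inner_mul_inner_self_le (y - ⟪x, y⟫ • x) (z - ⟪x, z⟫ • x)
  simp only [inner_sub_left, inner_sub_right, real_inner_smul_left, real_inner_smul_right,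
    real_inner_self_eq_norm_sq, hx, hy, hz, real_inner_comm x y, real_inner_comm x z,
    norm_smul, Real.norm_eq_abs, mul_one, sq_abs] at key
  linarith

open scoped Classical in
/-- Corollary cor31: with `F₀ = 0` and `h₀ = 1`, if `S_h(C) ≥ 0` then
`R_g(C) ≥ (N - M)/(3N)` where `M = F(1,1,1) + 3h(1)`. -/
theorem distance_distribution_bound_cor31
    (n N : ℕ) (hn : 1 ≤ n) (hN : 2 ≤ N)
    (T : Set ℝ) (hTsub : T ⊆ Set.Ico (-1 : ℝ) 1)
    (C : Finset (EuclideanSpace ℝ (Fin n))) (hcard : C.card = N)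
    (hunit : ∀ x ∈ C, ‖x‖ = 1)
    (hcode : ∀ x ∈ C, ∀ y ∈ C, x ≠ y → ⟪x, y⟫ ∈ T)
    (F : ℝ → ℝ → ℝ → ℝ)
    (hsym1 : ∀ a b c : ℝ, F a b c = F b a c)
    (hsym2 : ∀ a b c : ℝ, F a b c = F a c b)
    (h g : ℝ → ℝ) (M : ℝ) (hM : M = F 1 1 1 + 3 * h 1)
    (h1 : ∀ t ∈ T, h t + 1 + F 1 t t ≤ 2 * g t)
    (h2 : ∀ t ∈ T, ∀ u ∈ T, ∀ v ∈ T,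
      0 ≤ 1 + 2 * t * u * v - t ^ 2 - u ^ 2 - v ^ 2 →
        F t u v ≤ g t + g u + g v)
    (hSF : 0 ≤ ∑ x ∈ C, ∑ y ∈ C, ∑ z ∈ C, F ⟪x, y⟫ ⟪x, z⟫ ⟪y, z⟫)
    (hSh : 0 ≤ ∑ x ∈ C, ∑ y ∈ C, h ⟪x, y⟫) :
    ((N : ℝ) - M) / (3 * (N : ℝ)) ≤
      (∑ x ∈ C, ∑ y ∈ C.erase x, g ⟪x, y⟫) / (N : ℝ) := by
  have hself : ∀ x ∈ C, ⟪x, x⟫ = (1 : ℝ) := fun x hx => by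
    rw [real_inner_self_eq_norm_sq, hunit x hx, one_pow]
  have hNpos : (0 : ℝ) < N := by exact_mod_cast (by omega : 0 < N)
  have hN2 : (2 : ℝ) ≤ N := by exact_mod_cast hN
  set w : EuclideanSpace ℝ (Fin n) → EuclideanSpace ℝ (Fin n) → ℝ :=
    fun x y => if x = y then 0 else g ⟪x, y⟫ with hw
  set S : ℝ := ∑ x ∈ C, ∑ y ∈ C, w x y with hS
  have hE : ∑ x ∈ C, ∑ y ∈ C.erase x, g ⟪x, y⟫ = S := by
    refine Finset.sum_congr rfl fun x _ => ?_
    rw [← Finset.sum_erase (s := C) (a := x) (f := fun y => w x y) (by simp [hw])]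
    refine Finset.sum_congr rfl fun y hy => ?_
    simp [hw, (Finset.ne_of_mem_erase hy).symm]
  have hpt : ∀ x ∈ C, ∀ y ∈ C, ∀ z ∈ C, F ⟪x, y⟫ ⟪x, z⟫ ⟪y, z⟫ ≤
      w x y + w x z + w y z + (if x = y then -h ⟪x, z⟫ - 1 else 0)
        + (if x = z then -h ⟪x, y⟫ - 1 else 0) + (if y = z then -h ⟪x, y⟫ - 1 else 0)
        + (if x = y then (if x = z then M + 3 else 0) else 0) := by
    intro x hx y hy z hz
    by_cases hxy : x = y
    · subst hxy
      by_cases hxz : x = z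
      · subst hxz
        simp only [hw, hself x hx, if_true]
        linarith
      · have := h1 _ (hcode x hx z hz hxz)
        simp only [hw, hself x hx, hxz, if_true, if_false]
        linarith
    · have hxy' := h1 _ (hcode x hx y hy hxy)
      by_cases hxz : x = z
      · subst hxz
        simp only [hw, hself x hx, hxy, Ne.symm hxy, if_true, if_false, real_inner_comm x y]
        rw [hsym1]
        linarith
      · by_cases hyz : y = z
        · subst hyz
          simp only [hw, hself y hy, hxy, if_true, if_false]
          rw [hsym2, hsym1]
          linarith
        · have := h2 _ (hcode x hx y hy hxy) _ (hcode x hx z hz hxz) _ (hcode y hy z hz hyz)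
            (gram_det_nonneg_of_norm_eq_one (hunit x hx) (hunit y hy) (hunit z hz))
          simp only [hw, hxy, hxz, hyz, if_false]
          linarith
  have hsum := hSF.trans (Finset.sum_le_sum fun x hx => Finset.sum_le_sum fun y hy =>
    Finset.sum_le_sum fun z hz => hpt x hx y hy z hz)
  have hxy_sum : ∑ x ∈ C, ∑ y ∈ C, ∑ z ∈ C, (if x = y then -h ⟪x, z⟫ - 1 else 0) =
      ∑ x ∈ C, ∑ z ∈ C, (-h ⟪x, z⟫ - 1) := by
    refine Finset.sum_congr rfl fun x hx => ?_
    rw [Finset.sum_comm]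
    exact Finset.sum_congr rfl fun z _ => by rw [Finset.sum_ite_eq, if_pos hx]
  have hxz_sum : ∑ x ∈ C, ∑ y ∈ C, ∑ z ∈ C, (if x = z then -h ⟪x, y⟫ - 1 else 0) =
      ∑ x ∈ C, ∑ y ∈ C, (-h ⟪x, y⟫ - 1) :=
    Finset.sum_congr rfl fun x hx => Finset.sum_congr rfl fun y _ => by
      rw [Finset.sum_ite_eq, if_pos hx]
  have hyz_sum : ∑ x ∈ C, ∑ y ∈ C, ∑ z ∈ C, (if y = z then -h ⟪x, y⟫ - 1 else 0) =
      ∑ x ∈ C, ∑ y ∈ C, (-h ⟪x, y⟫ - 1) :=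
    Finset.sum_congr rfl fun x _ => Finset.sum_congr rfl fun y hy => by
      rw [Finset.sum_ite_eq, if_pos hy]
  have hdiag : ∑ x ∈ C, ∑ y ∈ C, ∑ z ∈ C,
      (if x = y then (if x = z then M + 3 else 0) else 0) = N * (M + 3) := by
    have : ∀ x ∈ C, ∑ y ∈ C, ∑ z ∈ C,
        (if x = y then (if x = z then M + 3 else 0) else 0) = M + 3 := fun x hx => by
      rw [Finset.sum_comm]
      simp only [Finset.sum_ite_eq, if_pos hx]
    rw [Finset.sum_congr rfl this, Finset.sum_const, hcard, nsmul_eq_mul]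
  have hh : ∑ x ∈ C, ∑ y ∈ C, (-h ⟪x, y⟫ - 1) =
      -(∑ x ∈ C, ∑ y ∈ C, h ⟪x, y⟫) - (N : ℝ) * N := by
    simp [Finset.sum_sub_distrib, Finset.sum_neg_distrib, hcard]
  have hw_xy : ∑ x ∈ C, ∑ y ∈ C, ∑ _z ∈ C, w x y = N * S := by
    simp only [Finset.sum_const, hcard, nsmul_eq_mul, ← Finset.mul_sum, hS]
  have hw_xz : ∑ x ∈ C, ∑ _y ∈ C, ∑ z ∈ C, w x z = N * S := by
    simp only [Finset.sum_const, hcard, nsmul_eq_mul, ← Finset.mul_sum, hS]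
  have hw_yz : ∑ _x ∈ C, ∑ y ∈ C, ∑ z ∈ C, w y z = N * S := by
    rw [Finset.sum_const, hcard, nsmul_eq_mul]
  simp only [Finset.sum_add_distrib] at hsum
  rw [hw_xy, hw_xz, hw_yz, hxy_sum, hxz_sum, hyz_sum, hdiag, hh] at hsum
  have hmul : 0 ≤ (N : ℝ) * (3 * S - 3 * N + M + 3) := by linarith
  have hbound := nonneg_of_mul_nonneg_right hmul hNpos
  rw [hE, ← div_div]
  gcongr
  linarith
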